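/- arXiv:1104.4258 — 2 statements merged into one kernel-verified Lean document; each statement's English description precedes it below -/
import Mathlib

section
/- The functions (t, ω) ↦ X_n(t, ω) · 𝟙_{[0, σ_∞(ω) ∧ σ_n(ω))}(t) converge to (t, ω) ↦ X_∞(t, ω) · 𝟙_{[0, σ_∞(ω))}(t) in measure with respect to the product measure ℙ ⊗ Lebesgue on Ω × [0,T]; that is, for every δ > 0 the (ℙ ⊗ Leb)-measure of the set where the norm of the difference exceeds δ tends to 0 as n → ∞. -/
open MeasureTheory Filter Set

section aux
variable {E : Type*} [NormedAddCommGroup E]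

lemma rho_bdd (x : ℝ → E) (s T r : ℝ) (hT : 0 < T) :
    BddBelow ({t : ℝ | t ∈ Set.Ioo 0 s ∧ r < ‖x t‖} ∪ {T}) := by
  refine ⟨0, ?_⟩
  rintro t (⟨ht, -⟩ | rfl)
  · exact ht.1.le
  · exact hT.le

lemma rho_nonneg (x : ℝ → E) (s T r : ℝ) (hT : 0 < T) :
    0 ≤ sInf ({t : ℝ | t ∈ Set.Ioo 0 s ∧ r < ‖x t‖} ∪ {T}) := by
  apply le_csInf ⟨T, Or.inr rfl⟩
  rintro t (⟨ht, -⟩ | rfl)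
  · exact ht.1.le
  · exact hT.le

lemma rho_le_T (x : ℝ → E) (s T r : ℝ) (hT : 0 < T) :
    sInf ({t : ℝ | t ∈ Set.Ioo 0 s ∧ r < ‖x t‖} ∪ {T}) ≤ T :=
  csInf_le (rho_bdd x s T r hT) (Or.inr rfl)

lemma rho_le_s (x : ℝ → E) (s T r : ℝ) (hT : 0 < T) (hs : s ∈ Set.Ioc 0 T)
    (he : s < T → ∀ M : ℝ, ∃ᶠ t in nhdsWithin s (Set.Iio s), M < ‖x t‖) :
    sInf ({t : ℝ | t ∈ Set.Ioo 0 s ∧ r < ‖x t‖} ∪ {T}) ≤ s := by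
  rcases hs.2.lt_or_eq with h | h
  · have h1 : ∀ᶠ t in nhdsWithin s (Set.Iio s), t ∈ Set.Ioo 0 s := Ioo_mem_nhdsLT hs.1
    obtain ⟨t, ht, ht2⟩ := ((he h r).and_eventually h1).exists
    exact (csInf_le (rho_bdd x s T r hT) (Or.inl ⟨ht2, ht⟩)).trans ht2.2.le
  · rw [h]; exact rho_le_T x T T r hT

lemma norm_le_of_lt_rho (x : ℝ → E) (s T r : ℝ) (hT : 0 < T) (hs : s ∈ Set.Ioc 0 T)
    (he : s < T → ∀ M : ℝ, ∃ᶠ t in nhdsWithin s (Set.Iio s), M < ‖x t‖)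
    (hc : ContinuousOn x (Set.Ico 0 s)) (t : ℝ) (ht0 : 0 ≤ t)
    (ht : t < sInf ({t : ℝ | t ∈ Set.Ioo 0 s ∧ r < ‖x t‖} ∪ {T})) : ‖x t‖ ≤ r := by
  have key : ∀ t, 0 < t → t < sInf ({t : ℝ | t ∈ Set.Ioo 0 s ∧ r < ‖x t‖} ∪ {T}) →
      ‖x t‖ ≤ r := by
    intro t ht0 ht
    by_contra! hcon
    exact notMem_of_lt_csInf ht (rho_bdd x s T r hT)
      (Or.inl ⟨⟨ht0, ht.trans_le (rho_le_s x s T r hT hs he)⟩, hcon⟩)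
  rcases ht0.lt_or_eq with h | h
  · exact key t h ht
  · subst h
    have h1 : Tendsto (fun t => ‖x t‖) (nhdsWithin 0 (Set.Ioi 0)) (nhds ‖x 0‖) := by
      have h2 := (hc 0 ⟨le_rfl, hs.1⟩).norm
      refine h2.mono_left ?_
      rw [← nhdsWithin_Ioo_eq_nhdsGT hs.1]
      exact nhdsWithin_mono _ Ioo_subset_Ico_self
    refine le_of_tendsto h1 ?_
    filter_upwards [Ioo_mem_nhdsGT ht] with t ht using key t ht.1 ht.2

lemma le_norm_rho (x : ℝ → E) (s T r : ℝ) (hT : 0 < T)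
    (hc : ContinuousOn x (Set.Ico 0 s))
    (h : sInf ({t : ℝ | t ∈ Set.Ioo 0 s ∧ r < ‖x t‖} ∪ {T}) < T) :
    r ≤ ‖x (sInf ({t : ℝ | t ∈ Set.Ioo 0 s ∧ r < ‖x t‖} ∪ {T}))‖ := by
  have hbd := rho_bdd x s T r hT
  have hnn := rho_nonneg x s T r hT
  have hne : ({t : ℝ | t ∈ Set.Ioo 0 s ∧ r < ‖x t‖} ∪ {T}).Nonempty := ⟨T, Or.inr rfl⟩
  have hex : ∀ c, sInf ({t : ℝ | t ∈ Set.Ioo 0 s ∧ r < ‖x t‖} ∪ {T}) < c →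
      ∃ t ∈ Set.Ioo 0 s, r < ‖x t‖ ∧ t < c ∧
        sInf ({t : ℝ | t ∈ Set.Ioo 0 s ∧ r < ‖x t‖} ∪ {T}) ≤ t := by
    intro c hcc
    obtain ⟨t, ht, htc⟩ := exists_lt_of_csInf_lt hne (lt_min hcc h)
    have hle := csInf_le hbd ht
    rcases ht with ⟨h1, h2⟩ | h1
    · exact ⟨t, h1, h2, htc.trans_le (min_le_left _ _), hle⟩
    · have h2 := htc.trans_le (min_le_right _ _)
      rw [mem_singleton_iff.1 h1] at h2
      exact absurd h2 (lt_irrefl _)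
  generalize sInf ({t : ℝ | t ∈ Set.Ioo 0 s ∧ r < ‖x t‖} ∪ {T}) = ρ at *
  by_contra! hcon
  obtain ⟨t0, ht0, -, -, hle0⟩ := hex T h
  have h2 := (hc ρ ⟨hnn, hle0.trans_lt ht0.2⟩).norm
  have h3 := h2.eventually_lt_const hcon
  rw [eventually_nhdsWithin_iff, Metric.eventually_nhds_iff] at h3
  obtain ⟨d, hd, h3⟩ := h3
  obtain ⟨t, ht, hrt, htc, hle⟩ := hex (ρ + d) (by linarith)
  have := h3 (y := t) (by rw [Real.dist_eq, abs_of_nonneg] <;> linarith) ⟨ht.1.le, ht.2⟩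
  exact absurd this (not_lt.2 hrt.le)

/-- first passage before `c` is detected at rational times -/
lemma rho_lt_iff (x : ℝ → E) (s T r c : ℝ)  (hs : s ∈ Set.Ioc 0 T)
    (hc : ContinuousOn x (Set.Ico 0 s)) :
    sInf ({t : ℝ | t ∈ Set.Ioo 0 s ∧ r < ‖x t‖} ∪ {T}) < c ↔
      T < c ∨ ∃ q : ℚ, (0 : ℝ) < q ∧ (q : ℝ) < c ∧ (q : ℝ) < s ∧ r < ‖x q‖ := by
  have hT : 0 < T := hs.1.trans_le hs.2
  rw [csInf_lt_iff (rho_bdd x s T r hT) ⟨T, Or.inr rfl⟩]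
  constructor
  · rintro ⟨t, ⟨⟨h0, h1⟩, h2⟩ | h1, htc⟩
    · right
      have h3 : ContinuousAt x t :=
        (hc t ⟨h0.le, h1⟩).continuousAt (Ico_mem_nhds h0 h1)
      have h4 := h3.norm.eventually_const_lt h2
      have h5 : ∀ᶠ u in nhds t, r < ‖x u‖ ∧ u ∈ Ioo 0 (min c s) :=
        h4.and (Ioo_mem_nhds h0 (lt_min htc h1))
      obtain ⟨q, hq⟩ :=
        (Rat.denseRange_cast (𝕜 := ℝ)).exists_mem_open isOpen_interior
          ⟨t, mem_interior_iff_mem_nhds.2 h5⟩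
      obtain ⟨h6, h7⟩ := interior_subset hq
      exact ⟨q, h7.1, h7.2.trans_le (min_le_left _ _), h7.2.trans_le (min_le_right _ _), h6⟩
    · left; rw [mem_singleton_iff.1 h1] at htc; exact htc
  · rintro (h | ⟨q, h0, h1, h2, h3⟩)
    · exact ⟨T, Or.inr rfl, h⟩
    · exact ⟨q, Or.inl ⟨⟨h0, h2⟩, h3⟩, h1⟩

/-- the first passage times exhaust `[0,s)` -/
lemma exists_lt_rho (x : ℝ → E) (s T : ℝ) (hs : s ∈ Set.Ioc 0 T)
    (hc : ContinuousOn x (Set.Ico 0 s)) (t : ℝ) (ht : t < s) :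
    ∃ k : ℕ, t < sInf ({u : ℝ | u ∈ Set.Ioo 0 s ∧ ((k : ℝ) + 1) < ‖x u‖} ∪ {T}) := by
  obtain ⟨t', h1, h2⟩ := exists_between ht
  have h3 : ContinuousOn x (Set.Icc 0 t') := hc.mono fun u hu => ⟨hu.1, hu.2.trans_lt h2⟩
  obtain ⟨C, hC⟩ := isCompact_Icc.exists_bound_of_continuousOn h3
  obtain ⟨k, hk⟩ := exists_nat_ge C
  refine ⟨k, h1.trans_le (le_csInf ⟨T, Or.inr rfl⟩ ?_)⟩
  rintro u (⟨hu, hu2⟩ | hu)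
  · by_contra! hcon
    have := hC u ⟨hu.1.le, hcon.le⟩
    linarith
  · rw [mem_singleton_iff.1 hu]; exact (h2.le.trans hs.2)

end aux

theorem stmt_4
    {Ω : Type*} [MeasurableSpace Ω] (P : Measure Ω) [IsProbabilityMeasure P]
    {E : Type*} [NormedAddCommGroup E] [NormedSpace ℝ E] [CompleteSpace E]
    [MeasurableSpace E] [BorelSpace E]
    (T : ℝ) (hT : 0 < T)
    -- the explosion times σ_n (n ∈ ℕ) and σ_∞
    (σ : ℕ → Ω → ℝ) (σi : Ω → ℝ)
    (hσmeas : ∀ n, Measurable (σ n)) (hσimeas : Measurable σi)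
    (hσmem : ∀ n ω, σ n ω ∈ Set.Ioc 0 T) (hσimem : ∀ ω, σi ω ∈ Set.Ioc 0 T)
    -- the processes X_n (n ∈ ℕ) and X_∞, jointly measurable
    (X : ℕ → ℝ → Ω → E) (Xi : ℝ → Ω → E)
    (hXmeas : ∀ n, Measurable fun p : ℝ × Ω => X n p.1 p.2)
    (hXimeas : Measurable fun p : ℝ × Ω => Xi p.1 p.2)
    -- path continuity on [0, σ_n(ω)), and on [0,T] if σ_n(ω) = T
    (hXcont : ∀ n ω, ContinuousOn (fun t => X n t ω) (Set.Ico 0 (σ n ω)))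
    (hXcontT : ∀ n ω, σ n ω = T → ContinuousOn (fun t => X n t ω) (Set.Icc 0 T))
    (hXicont : ∀ ω, ContinuousOn (fun t => Xi t ω) (Set.Ico 0 (σi ω)))
    (hXicontT : ∀ ω, σi ω = T → ContinuousOn (fun t => Xi t ω) (Set.Icc 0 T))
    -- σ_n is an explosion time: on {σ_n < T}, limsup_{t ↑ σ_n} ‖X_n(t)‖ = ∞
    (hexpl : ∀ n ω, σ n ω < T →
      ∀ M : ℝ, ∃ᶠ t in nhdsWithin (σ n ω) (Set.Iio (σ n ω)), M < ‖X n t ω‖)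
    (hexpli : ∀ ω, σi ω < T →
      ∀ M : ℝ, ∃ᶠ t in nhdsWithin (σi ω) (Set.Iio (σi ω)), M < ‖Xi t ω‖)
    -- the stopping times ρ_n^{(r)} = inf { t ∈ (0, σ_n) : ‖X_n(t)‖ > r }, inf ∅ := T
    (ρ : ℕ → ℝ → Ω → ℝ) (ρi : ℝ → Ω → ℝ)
    (hρ : ∀ n r ω, ρ n r ω = sInf ({t : ℝ | t ∈ Set.Ioo 0 (σ n ω) ∧ r < ‖X n t ω‖} ∪ {T}))
    (hρi : ∀ r ω, ρi r ω = sInf ({t : ℝ | t ∈ Set.Ioo 0 (σi ω) ∧ r < ‖Xi t ω‖} ∪ {T}))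
    -- the globally defined processes X_n^{(r)} (denoted Y n r) and X_∞^{(r)} (denoted Yi r)
    (Y : ℕ → ℝ → ℝ → Ω → E) (Yi : ℝ → ℝ → Ω → E)
    (hYmeas : ∀ n r, Measurable fun p : ℝ × Ω => Y n r p.1 p.2)
    (hYimeas : ∀ r, Measurable fun p : ℝ × Ω => Yi r p.1 p.2)
    (hYcont : ∀ n r ω, Continuous fun t => Y n r t ω)
    (hYicont : ∀ r ω, Continuous fun t => Yi r t ω)
    -- assumption (a)
    (ha : ∀ n r, 0 < r → ∀ᵐ ω ∂P, ∀ t ∈ Set.Icc 0 (ρ n r ω), Y n r t ω = X n t ω)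
    (hai : ∀ r, 0 < r → ∀ᵐ ω ∂P, ∀ t ∈ Set.Icc 0 (ρi r ω), Yi r t ω = Xi t ω)
    -- assumption (b): X_n^{(r)} → X_∞^{(r)} in L⁰(Ω; C([0,T]; E))
    (hb : ∀ r, 0 < r → TendstoInMeasure P
      (fun n ω => ⨆ t : Set.Icc (0:ℝ) T, ‖Y n r (t : ℝ) ω - Yi r (t : ℝ) ω‖)
      atTop (fun _ => (0 : ℝ)))    :
    TendstoInMeasure (P.prod (volume.restrict (Set.Icc (0:ℝ) T)))
      (fun n p => Set.indicator (Set.Ico 0 (min (σi p.1) (σ n p.1))) (fun s => X n s p.1) p.2)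
      atTop
      (fun p => Set.indicator (Set.Ico 0 (σi p.1)) (fun s => Xi s p.1) p.2) := by
  have hρimeas : ∀ r, Measurable (ρi r) := by
    intro r
    refine measurable_of_Iio fun c => ?_
    have : ρi r ⁻¹' Iio c = {ω | T < c} ∪ ⋃ q : ℚ, {ω | (0 : ℝ) < q ∧ (q : ℝ) < c} ∩
        ({ω | (q : ℝ) < σi ω} ∩ {ω | r < ‖Xi q ω‖}) := by
      ext ω
      have := rho_lt_iff (fun t => Xi t ω) (σi ω) T r c (hσimem ω) (hXicont ω)
      rw [← hρi] at this
      simp only [mem_preimage, mem_Iio, this, mem_union, mem_iUnion, mem_inter_iff, mem_setOf_eq,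
        and_assoc]
    rw [this]
    refine (MeasurableSet.const _).union (MeasurableSet.iUnion fun q =>
      (MeasurableSet.const _).inter ((measurableSet_lt measurable_const hσimeas).inter
        (measurableSet_lt measurable_const ?_)))
    exact (hXimeas.comp (measurable_const.prodMk measurable_id)).norm
  have hmono : ∀ ω, Monotone fun r => ρi r ω := by
    intro ω r r' hr
    simp only [hρi]
    refine csInf_le_csInf (rho_bdd (fun t => Xi t ω) _ T r hT) ⟨T, Or.inr rfl⟩ ?_
    exact union_subset_union_left _ fun t ht => ⟨ht.1, hr.trans_lt ht.2⟩
  set m := P.prod (volume.restrict (Set.Icc (0:ℝ) T)) with hm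
  let A : ℕ → Set (Ω × ℝ) := fun k => {p | ρi ((k : ℝ) + 1) p.1 ≤ p.2 ∧ p.2 < σi p.1}
  have hAmeas : ∀ k, MeasurableSet (A k) := fun k =>
    (measurableSet_le ((hρimeas _).comp measurable_fst) measurable_snd).inter
      (measurableSet_lt measurable_snd (hσimeas.comp measurable_fst))
  have hAanti : Antitone A := by
    intro k l hkl p hp
    refine ⟨(hmono p.1 ?_).trans hp.1, hp.2⟩
    have : (k : ℝ) ≤ l := by exact_mod_cast hkl
    linarith
  have hAinter : ⋂ k, A k = ∅ := by
    rw [eq_empty_iff_forall_notMem]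
    intro p hp
    rw [mem_iInter] at hp
    obtain ⟨k, hk⟩ := exists_lt_rho (fun t => Xi t p.1) (σi p.1) T (hσimem p.1) (hXicont p.1)
      p.2 (hp 0).2
    rw [← hρi] at hk
    exact absurd (hp k).1 (not_le.2 hk)
  have hAlim : Tendsto (fun k => m (A k)) atTop (nhds 0) := by
    have := tendsto_measure_iInter_atTop (μ := m) (fun k => (hAmeas k).nullMeasurableSet) hAanti
      ⟨0, measure_ne_top _ _⟩
    rwa [hAinter, measure_empty] at this
  rw [tendstoInMeasure_iff_norm]
  intro δ hδ
  rw [ENNReal.tendsto_nhds_zero]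
  intro η hη
  have hη2 : 0 < η / 2 := ENNReal.half_pos hη.ne'
  obtain ⟨k, hk⟩ := ((ENNReal.tendsto_nhds_zero.1 hAlim) (η / 2) hη2).exists
  have hr : (0 : ℝ) < (k : ℝ) + 2 := by positivity
  set r : ℝ := (k : ℝ) + 2 with hrdef
  have hε : 0 < min δ 1 := lt_min hδ one_pos
  have hb1 := tendstoInMeasure_iff_norm.1 (hb r hr) (min δ 1) hε
  have hb2 := ENNReal.Tendsto.mul_const (b := volume.restrict (Set.Icc (0:ℝ) T) univ) hb1
    (Or.inr (measure_ne_top _ _))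
  rw [zero_mul, ENNReal.tendsto_nhds_zero] at hb2
  filter_upwards [hb2 (η / 2) hη2] with n hn
  set B : Set Ω := {ω | min δ 1 ≤
    ‖(⨆ t : Set.Icc (0:ℝ) T, ‖Y n r (t : ℝ) ω - Yi r (t : ℝ) ω‖) - 0‖} with hB
  set N : Set Ω := {ω | ¬ ((∀ t ∈ Set.Icc 0 (ρ n r ω), Y n r t ω = X n t ω) ∧
    (∀ t ∈ Set.Icc 0 (ρi r ω), Yi r t ω = Xi t ω))} with hN
  have hN0 : P N = 0 := (ha n r hr).and (hai r hr)
  have hsub : {p : Ω × ℝ | δ ≤ ‖Set.indicator (Set.Ico 0 (min (σi p.1) (σ n p.1)))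
      (fun s => X n s p.1) p.2 - Set.indicator (Set.Ico 0 (σi p.1)) (fun s => Xi s p.1) p.2‖} ⊆
      A k ∪ (B ×ˢ univ ∪ N ×ˢ univ) := by
    rintro ⟨ω, t⟩ hp
    by_contra hcon
    simp only [mem_union, mem_prod, mem_univ, and_true, not_or] at hcon
    obtain ⟨hA, hBn, hNn⟩ := hcon
    simp only [mem_setOf_eq] at hp
    rw [hN, mem_setOf_eq, not_not] at hNn
    rw [hB, mem_setOf_eq, not_le, sub_zero] at hBn
    obtain ⟨hYX, hYXi⟩ := hNn
    by_cases ht : t ∈ Ico 0 (σi ω)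
    swap
    · rw [indicator_of_notMem ht, indicator_of_notMem, sub_zero, norm_zero] at hp
      · exact absurd hp (not_le.2 hδ)
      · exact fun h => ht ⟨h.1, h.2.trans_le (min_le_left _ _)⟩
    have htρ : t < ρi ((k : ℝ) + 1) ω := by
      by_contra! h
      exact hA ⟨h, ht.2⟩
    have hclose : ∀ u ∈ Icc 0 T, ‖Y n r u ω - Yi r u ω‖ < min δ 1 := by
      intro u hu
      have hbdd : BddAbove (range fun t : Set.Icc (0:ℝ) T => ‖Y n r (t : ℝ) ω - Yi r (t : ℝ) ω‖) := by
        have hcont : Continuous fun t : Set.Icc (0:ℝ) T => ‖Y n r (t : ℝ) ω - Yi r (t : ℝ) ω‖ :=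
          (((hYcont n r ω).comp continuous_subtype_val).sub
            ((hYicont r ω).comp continuous_subtype_val)).norm
        exact (isCompact_range hcont).bddAbove
      exact ((le_ciSup hbdd ⟨u, hu⟩).trans (Real.le_norm_self _)).trans_lt hBn
    have hρr : ρi ((k : ℝ) + 1) ω ≤ ρi r ω := hmono ω (by rw [hrdef]; linarith)
    have hρT : ρi ((k : ℝ) + 1) ω ≤ T := by
      rw [hρi]; exact rho_le_T (fun t => Xi t ω) _ T _ hT
    have hge : ρi ((k : ℝ) + 1) ω ≤ ρ n r ω := by
      by_contra! hlt
      have h0 : 0 ≤ ρ n r ω := by rw [hρ]; exact rho_nonneg (fun t => X n t ω) _ T _ hT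
      have h1 : r ≤ ‖X n (ρ n r ω) ω‖ := by
        have := le_norm_rho (fun t => X n t ω) (σ n ω) T r hT (hXcont n ω)
        rw [← hρ] at this
        exact this (hlt.trans_le hρT)
      have h2 : ‖Xi (ρ n r ω) ω‖ ≤ (k : ℝ) + 1 := by
        have := norm_le_of_lt_rho (fun t => Xi t ω) (σi ω) T ((k : ℝ) + 1) hT (hσimem ω)
          (hexpli ω) (hXicont ω) (ρ n r ω) h0
        rw [← hρi] at this
        exact this hlt
      have h3 := hclose (ρ n r ω) ⟨h0, hlt.le.trans hρT⟩
      rw [hYX _ ⟨h0, le_rfl⟩, hYXi _ ⟨h0, hlt.le.trans hρr⟩] at h3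
      have h4 := norm_sub_norm_le (X n (ρ n r ω) ω) (Xi (ρ n r ω) ω)
      have h5 := h3.trans_le (min_le_right _ _)
      linarith
    have hσn : ρ n r ω ≤ σ n ω := by
      rw [hρ]; exact rho_le_s (fun t => X n t ω) _ T _ hT (hσmem n ω) (hexpl n ω)
    have htn : t < ρ n r ω := htρ.trans_le hge
    rw [indicator_of_mem ht, indicator_of_mem (show t ∈ Ico 0 (min (σi ω) (σ n ω)) from
      ⟨ht.1, lt_min ht.2 (htn.trans_le hσn)⟩), ← hYX t ⟨ht.1, htn.le⟩,
      ← hYXi t ⟨ht.1, (htρ.trans_le hρr).le⟩] at hp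
    have := (hclose t ⟨ht.1, htρ.le.trans hρT⟩).trans_le (min_le_left _ _)
    linarith
  calc m _ ≤ m (A k ∪ (B ×ˢ univ ∪ N ×ˢ univ)) := measure_mono hsub
    _ ≤ m (A k) + (m (B ×ˢ univ) + m (N ×ˢ univ)) :=
      (measure_union_le _ _).trans (by gcongr; exact measure_union_le _ _)
    _ ≤ η / 2 + (η / 2 + 0) := by
      gcongr
      · rw [hm, Measure.prod_prod]; exact hn
      · rw [hm, Measure.prod_prod, hN0, zero_mul]
    _ = η := by rw [add_zero, ENNReal.add_halves]
end

section
/- Let (S(t))_{t≥0} be a strongly continuous contraction semigroup on B with generator A, let T > 0, and let F : [0,T] × B → B satisfy: (i) for every x ∈ B the map t ↦ F(t,x) is strongly measurable; (ii) for every r > 0 there is L_r ≥ 0 with ‖F(t,x) − F(t,y)‖ ≤ L_r ‖x − y‖ whenever ‖x‖, ‖y‖ ≤ r and t ∈ [0,T]; (iii) there is C₀ ≥ 0 with ‖F(t,0)‖ ≤ C₀ for all t ∈ [0,T]; (iv) there are constants a', b' ≥ 0 and N ≥ 1 such that ⟨Ax + F(t, x+y), x*⟩ ≤ a'(1 + ‖y‖)^N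 + b'‖x‖ for all t ∈ [0,T], x ∈ D(A), y ∈ B and x* ∈ ∂‖x‖. Let x ∈ B, τ ∈ (0, T], and let u, v : [0, τ) → B be continuous functions such that u(t) = S(t)x + ∫₀ᵗ S(t−s) F(s, u(s) + v(s)) ds (Bochner integral) for all t ∈ [0, τ). Then ‖u(t)‖ ≤ e^{b' t} ( ‖x‖ + ∫₀ᵗ a'(1 + ‖v(s)‖)^N ds ) for all t ∈ [0, τ). -/
open MeasureTheory Filter Set

theorem aux_int {E : Type*} [NormedAddCommGroup E] (f : ℝ → E) (C : ℝ)
    (hf : AEStronglyMeasurable f volume) (hC : ∀ s, ‖f s‖ ≤ C) (a b : ℝ) :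
    IntervalIntegrable f volume a b := by
  refine (intervalIntegrable_const (c := C)).mono_fun hf.restrict ?_
  filter_upwards with s
  exact (hC s).trans (le_abs_self C)

theorem aux_joint {B : Type*} [NormedAddCommGroup B] [NormedSpace ℝ B]
    (U : ℝ → B →L[ℝ] B) (hU1 : ∀ t, ‖U t‖ ≤ 1) (hUc : ∀ x, Continuous fun t => U t x) :
    Continuous (fun p : ℝ × B => U p.1 p.2) := by
  rw [continuous_iff_continuousAt]
  rintro ⟨t, x⟩
  have h1 : Tendsto (fun p : ℝ × B => U p.1 x) (nhds (t, x)) (nhds (U t x)) :=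
    ((hUc x).comp continuous_fst).tendsto (t, x)
  have h2 : Tendsto (fun p : ℝ × B => U p.1 (p.2 - x)) (nhds (t, x)) (nhds 0) := by
    have h3 : Tendsto (fun p : ℝ × B => ‖p.2 - x‖) (nhds (t, x)) (nhds 0) := by
      have : Continuous (fun p : ℝ × B => ‖p.2 - x‖) := by fun_prop
      simpa using this.tendsto (t, x)
    refine squeeze_zero_norm (fun p => ?_) h3
    calc ‖U p.1 (p.2 - x)‖ ≤ 1 * ‖p.2 - x‖ := (U p.1).le_of_opNorm_le (hU1 _) _
      _ = _ := one_mul _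
  have := h1.add h2
  simpa [ContinuousAt, ← map_add] using this

theorem aux_meas {B : Type*} [NormedAddCommGroup B] (F : ℝ → B → B) (T : ℝ)
    (hFmeas : ∀ x : B, AEStronglyMeasurable (fun t => F t x) (volume.restrict (Set.Icc 0 T)))
    (hFlip : ∀ r : ℝ, 0 < r → ∃ L : ℝ, 0 ≤ L ∧ ∀ t ∈ Set.Icc 0 T, ∀ x y : B,
      ‖x‖ ≤ r → ‖y‖ ≤ r → ‖F t x - F t y‖ ≤ L * ‖x - y‖)
    (g : ℝ → B) (hg : Continuous g) :
    AEStronglyMeasurable (fun t => F t (g t)) (volume.restrict (Set.Icc 0 T)) := by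
  have hgm : StronglyMeasurable g := hg.stronglyMeasurable
  refine aestronglyMeasurable_of_tendsto_ae atTop (f := fun n t => F t (hgm.approx n t)) ?_ ?_
  · intro n
    have : (fun t => F t (hgm.approx n t)) = fun t => ∑ y ∈ (hgm.approx n).range,
        ((hgm.approx n) ⁻¹' {y}).indicator (fun t => F t y) t := by
      funext t
      rw [Finset.sum_eq_single (hgm.approx n t)]
      · simp
      · intro y _ hy
        exact Set.indicator_of_notMem (by simpa using hy.symm) _
      · intro h
        exact absurd ((hgm.approx n).mem_range_self t) h
    rw [this]
    refine Finset.aestronglyMeasurable_fun_sum _ fun y _ => ?_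
    exact (hFmeas y).indicator ((hgm.approx n).measurableSet_fiber y)
  · filter_upwards [ae_restrict_mem measurableSet_Icc] with t ht
    obtain ⟨L, hL, hLip⟩ := hFlip (‖g t‖ + 1) (by positivity)
    have h1 := hgm.tendsto_approx t
    have h2 : ∀ᶠ n in atTop, ‖hgm.approx n t‖ ≤ ‖g t‖ + 1 :=
      (h1.norm.eventually_lt_const (lt_add_one _)).mono fun n h => h.le
    rw [tendsto_iff_norm_sub_tendsto_zero] at h1 ⊢
    refine squeeze_zero' (Eventually.of_forall fun _ => norm_nonneg _) ?_
      (by simpa using h1.const_mul L)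
    filter_upwards [h2] with n hn
    exact hLip t ht _ _ hn (by linarith)

theorem aux_M {B : Type*} [NormedAddCommGroup B] [NormedSpace ℝ B] [CompleteSpace B]
    (U : ℝ → B →L[ℝ] B) (hU0 : U 0 = ContinuousLinearMap.id ℝ B)
    (hUadd : ∀ s ≥ (0:ℝ), ∀ t ≥ (0:ℝ), U (s + t) = (U s).comp (U t))
    (hU1 : ∀ t, ‖U t‖ ≤ 1) (hUc : ∀ x, Continuous fun t => U t x) :
    ∃ M : ℝ → B →L[ℝ] B, (∀ h > 0, (∀ z, ‖M h z‖ ≤ ‖z‖) ∧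
      (∀ s ≥ 0, ∀ z, U s (M h z) = M h (U s z)) ∧
      (∃ K : ℝ, 0 ≤ K ∧ ∀ s ≥ 0, ∀ z, ‖U s (M h z) - M h z‖ ≤ K * s * ‖z‖) ∧
      (∃ AM : B →L[ℝ] B, ∀ z, Tendsto (fun s : ℝ => s⁻¹ • (U s (M h z) - M h z))
        (nhdsWithin 0 (Set.Ioi 0)) (nhds (AM z)))) ∧
      ∀ z, Tendsto (fun h => M h z) (nhdsWithin 0 (Set.Ioi 0)) (nhds z) := by
  have hi : ∀ z a b, IntervalIntegrable (fun t => U t z) volume a b :=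
    fun z a b => (hUc z).intervalIntegrable a b
  have hUz : ∀ t z, ‖U t z‖ ≤ ‖z‖ := fun t z => by
    simpa using (U t).le_of_opNorm_le (hU1 t) z
  let P : ℝ → B → B := fun h z => ∫ s in (0:ℝ)..h, U s z
  have hPn : ∀ h z, ‖P h z‖ ≤ |h| * ‖z‖ := fun h z => by
    have := intervalIntegral.norm_integral_le_of_norm_le_const (a := 0) (b := h)
      (f := fun s => U s z) (C := ‖z‖) (fun s _ => hUz s z)
    simpa [mul_comm] using this
  let M : ℝ → B →L[ℝ] B := fun h => LinearMap.mkContinuous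
    { toFun := fun z => h⁻¹ • P h z
      map_add' := fun y z => by
        simp only [P, map_add]
        rw [intervalIntegral.integral_add (hi y _ _) (hi z _ _), smul_add]
      map_smul' := fun c z => by
        simp only [P, map_smul, RingHom.id_apply]
        rw [intervalIntegral.integral_smul, smul_comm] } (|h⁻¹| * |h|) (fun z => by
        simp only [LinearMap.coe_mk, AddHom.coe_mk, norm_smul, Real.norm_eq_abs]
        rw [mul_assoc]
        exact mul_le_mul_of_nonneg_left (hPn h z) (abs_nonneg _))
  have hM : ∀ h z, M h z = h⁻¹ • P h z := fun h z => rfl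
  have hPd : ∀ z t, HasDerivAt (fun h => P h z) (U t z) t := fun z t =>
    ((hUc z).integral_hasStrictDerivAt 0 t).hasDerivAt
  have hP0 : ∀ z, P 0 z = 0 := fun z => by simp [P]
  have hUP : ∀ s ≥ 0, ∀ h > 0, ∀ z, U s (P h z) = P (h + s) z - P s z := by
    intro s hs h hh z
    simp only [P]
    rw [← ContinuousLinearMap.intervalIntegral_comp_comm _ (hi z _ _),
      intervalIntegral.integral_interval_sub_left (hi z _ _) (hi z _ _)]
    have := intervalIntegral.integral_comp_add_right (a := 0) (b := h) (fun r => U r z) s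
    rw [zero_add] at this
    rw [← this]
    refine intervalIntegral.integral_congr fun r hr => ?_
    rw [uIcc_of_le hh.le] at hr
    rw [add_comm r s, hUadd s hs r hr.1]
    rfl
  refine ⟨M, ?_, ?_⟩
  · intro h hh
    have key : ∀ s ≥ 0, ∀ z, U s (M h z) - M h z = h⁻¹ • ((P (h + s) z - P h z) - P s z) := by
      intro s hs z
      rw [hM, map_smul, hUP s hs h hh, ← smul_sub]
      congr 1; abel
    refine ⟨?_, ?_, ⟨2 * h⁻¹, by positivity, ?_⟩, ⟨h⁻¹ • (U h - U 0), ?_⟩⟩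
    · intro z
      rw [hM, norm_smul, Real.norm_eq_abs, abs_of_pos (inv_pos.2 hh)]
      calc h⁻¹ * ‖P h z‖ ≤ h⁻¹ * (|h| * ‖z‖) := by gcongr; exact hPn h z
        _ = ‖z‖ := by rw [abs_of_pos hh]; field_simp
    · intro s hs z
      rw [hM, hM, map_smul]
      congr 1
      simp only [P]
      rw [← ContinuousLinearMap.intervalIntegral_comp_comm _ (hi z _ _)]
      refine intervalIntegral.integral_congr fun r hr => ?_
      rw [uIcc_of_le hh.le] at hr
      rw [← ContinuousLinearMap.comp_apply, ← ContinuousLinearMap.comp_apply,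
        ← hUadd s hs r hr.1, ← hUadd r hr.1 s hs, add_comm]
    · intro s hs z
      rw [key s hs z, norm_smul, Real.norm_eq_abs, abs_of_pos (inv_pos.2 hh)]
      have h1 : ‖P (h + s) z - P h z‖ ≤ s * ‖z‖ := by
        simp only [P]
        rw [intervalIntegral.integral_interval_sub_left (hi z _ _) (hi z _ _)]
        have := intervalIntegral.norm_integral_le_of_norm_le_const (a := h) (b := h + s)
          (f := fun s => U s z) (C := ‖z‖) (fun s _ => hUz s z)
        simpa [mul_comm, abs_of_nonneg hs] using this
      have h2 : ‖P s z‖ ≤ s * ‖z‖ := by simpa [abs_of_nonneg hs] using hPn s z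
      calc h⁻¹ * ‖(P (h + s) z - P h z) - P s z‖ ≤ h⁻¹ * (s * ‖z‖ + s * ‖z‖) := by
            gcongr; exact (norm_sub_le _ _).trans (add_le_add h1 h2)
        _ = _ := by ring
    · intro z
      have h1 := (hPd z h).tendsto_slope_zero_right
      have h2 := (hPd z 0).tendsto_slope_zero_right
      have h3 := (h1.sub h2).const_smul h⁻¹
      have : (h⁻¹ • (U h - U 0)) z = h⁻¹ • (U h z - U 0 z) := rfl
      rw [this]
      refine h3.congr' ?_
      filter_upwards [self_mem_nhdsWithin] with s hs
      rw [key s (le_of_lt hs) z, ← smul_sub, smul_comm, zero_add, hP0, sub_zero]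
  · intro z
    have h2 := (hPd z 0).tendsto_slope_zero_right
    simpa [hP0, hU0, hM] using h2

theorem aux_step {B : Type*} [NormedAddCommGroup B] [NormedSpace ℝ B] [CompleteSpace B]
    [Nontrivial B]
    (U : ℝ → B →L[ℝ] B) (hU0 : U 0 = ContinuousLinearMap.id ℝ B)
    (hUadd : ∀ s ≥ (0:ℝ), ∀ t ≥ (0:ℝ), U (s + t) = (U s).comp (U t))
    (hU1 : ∀ t, ‖U t‖ ≤ 1) (hUc : ∀ x, Continuous fun t => U t x)
    (M AM : B →L[ℝ] B) (K : ℝ) (hK : 0 ≤ K) (hM1 : ∀ z, ‖M z‖ ≤ ‖z‖)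
    (hMU : ∀ s ≥ 0, ∀ z, U s (M z) = M (U s z))
    (hMK : ∀ s ≥ 0, ∀ z, ‖U s (M z) - M z‖ ≤ K * s * ‖z‖)
    (hAM : ∀ z, Tendsto (fun s : ℝ => s⁻¹ • (U s (M z) - M z))
        (nhdsWithin 0 (Set.Ioi 0)) (nhds (AM z)))
    (f : ℝ → B) (C : ℝ) (hf : AEStronglyMeasurable f volume) (hfC : ∀ s, ‖f s‖ ≤ C)
    (u : ℝ → B) (hu : Continuous u) (g : ℝ → ℝ) (hg : Continuous g) (x : B) (t1 : ℝ)
    (hueq : ∀ t ∈ Icc 0 t1, u t = U t x + ∫ s in (0:ℝ)..t, U (t - s) (f s))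
    (b L : ℝ) (hb : 0 ≤ b) (hL : 0 ≤ L)
    (hd : ∀ r ∈ Icc 0 t1, ∀ t ∈ Icc 0 t1, ∀ φ : B →L[ℝ] ℝ, ‖φ‖ = 1 → φ (M (u t)) = ‖M (u t)‖ →
      φ (AM (u t) + f r) ≤ g r + b * ‖M (u t)‖ + L * ‖u r - M (u t)‖) :
    ∀ t ∈ Icc 0 t1, ‖M (u t)‖ ≤ ‖M x‖ + ∫ r in (0:ℝ)..t,
      (g r + b * ‖M (u r)‖ + L * ‖u r - M (u r)‖ + ‖M (f r) - f r‖) := by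
  have hUj := aux_joint U hU1 hUc
  have hUz : ∀ t z, ‖U t z‖ ≤ ‖z‖ := fun t z => by
    simpa using (U t).le_of_opNorm_le (hU1 t) z
  have hC : 0 ≤ C := (norm_nonneg _).trans (hfC 0)
  -- integrability of the convolution integrand
  have hci : ∀ t p q, IntervalIntegrable (fun s => U (t - s) (f s)) volume p q := by
    intro t p q
    refine aux_int _ C ?_ (fun s => (hUz _ _).trans (hfC s)) p q
    exact hUj.comp_aestronglyMeasurable
      (((continuous_const.sub continuous_id).aestronglyMeasurable).prodMk hf)
  have hMc : ∀ t p q, IntervalIntegrable (fun s => U (t - s) (M (f s))) volume p q := by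
    intro t p q
    refine aux_int _ C ?_ (fun s => (hUz _ _).trans ((hM1 _).trans (hfC s))) p q
    exact hUj.comp_aestronglyMeasurable
      (((continuous_const.sub continuous_id).aestronglyMeasurable).prodMk
        (M.continuous.comp_aestronglyMeasurable hf))
  have hei : ∀ p q, IntervalIntegrable (fun r => ‖M (f r) - f r‖) volume p q := by
    intro p q
    refine aux_int _ (C + C) ((M.continuous.comp_aestronglyMeasurable hf).sub hf).norm ?_ p q
    intro s
    rw [norm_norm]
    exact (norm_sub_le _ _).trans (add_le_add ((hM1 _).trans (hfC s)) (hfC s))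
  set G : ℝ → ℝ := fun r => g r + b * ‖M (u r)‖ + L * ‖u r - M (u r)‖ + ‖M (f r) - f r‖ with hG
  have hGi : ∀ p q, IntervalIntegrable G volume p q := by
    intro p q
    refine IntervalIntegrable.add ?_ (hei p q)
    exact Continuous.intervalIntegrable (by fun_prop) p q
  -- the variation of constants formula
  have hvar : ∀ s ∈ Icc 0 t1, ∀ t ∈ Icc 0 t1, s ≤ t →
      M (u t) = U (t - s) (M (u s)) + ∫ r in s..t, U (t - r) (M (f r)) := by
    intro s hs t ht hst
    have hts : 0 ≤ t - s := sub_nonneg.2 hst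
    have e1 : u t = U (t - s) (u s) + ∫ r in s..t, U (t - r) (f r) := by
      rw [hueq t ht, hueq s hs, map_add, ← ContinuousLinearMap.intervalIntegral_comp_comm _ (hci s _ _),
        add_assoc]
      congr 1
      · rw [← ContinuousLinearMap.comp_apply, ← hUadd _ hts _ hs.1, sub_add_cancel]
      · rw [← intervalIntegral.integral_add_adjacent_intervals (hci t 0 s) (hci t s t)]
        congr 1
        refine intervalIntegral.integral_congr fun r hr => ?_
        rw [uIcc_of_le hs.1] at hr
        have : t - r = (t - s) + (s - r) := by ring
        show U (t - r) (f r) = U (t - s) (U (s - r) (f r))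
        rw [this, hUadd _ hts _ (sub_nonneg.2 hr.2)]
        rfl
    rw [e1, map_add, ← ContinuousLinearMap.intervalIntegral_comp_comm _ (hci t _ _), hMU _ hts]
    congr 1
    refine intervalIntegral.integral_congr fun r hr => ?_
    rw [uIcc_of_le hst] at hr
    exact (hMU _ (sub_nonneg.2 hr.2) _).symm
  -- the key local estimate
  have hloc : ∀ s ∈ Icc 0 t1, ∀ t ∈ Icc 0 t1, s < t → ∀ η, (∀ r ∈ Icc s t, ‖M (u r) - M (u t)‖ ≤ η) →
      ‖M (u t)‖ - ‖M (u s)‖ ≤ (∫ r in s..t, G r) + (t - s) *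
        (‖(t - s)⁻¹ • (U (t - s) (M (u s)) - M (u s)) - AM (u t)‖ + (b + L) * η + K * (t - s) * C) := by
    intro s hs t ht hst η hη
    have hσ : 0 < t - s := sub_pos.2 hst
    obtain ⟨φ, hφ1, hφ⟩ := exists_dual_vector' ℝ (M (u t))
    have hφ : φ (M (u t)) = ‖M (u t)‖ := by simpa using hφ
    have hφle : ∀ z, φ z ≤ ‖z‖ := fun z => by
      have := (le_abs_self _).trans (φ.le_opNorm z)
      rwa [hφ1, one_mul] at this
    set D := (t - s)⁻¹ • (U (t - s) (M (u s)) - M (u s)) - AM (u t) with hD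
    have e1 : U (t - s) (M (u s)) - M (u s) = (t - s) • (AM (u t) + D) := by
      rw [hD, add_sub_cancel, smul_inv_smul₀ hσ.ne']
    have e2 : ‖M (u t)‖ - ‖M (u s)‖ ≤ (t - s) * (φ (AM (u t)) + ‖D‖) +
        ∫ r in s..t, φ (U (t - r) (M (f r))) := by
      have : M (u t) - M (u s) = (t - s) • (AM (u t) + D) + ∫ r in s..t, U (t - r) (M (f r)) := by
        rw [← e1, hvar s hs t ht hst.le]; abel
      calc ‖M (u t)‖ - ‖M (u s)‖ ≤ φ (M (u t)) - φ (M (u s)) := by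
            rw [hφ]; linarith [hφle (M (u s))]
        _ = (t - s) * (φ (AM (u t)) + φ D) + ∫ r in s..t, φ (U (t - r) (M (f r))) := by
            rw [← map_sub, this, map_add, map_smul, map_add,
              ContinuousLinearMap.intervalIntegral_comp_comm _ (hMc t _ _), smul_eq_mul]
        _ ≤ _ := by gcongr; exact hφle D
    have e3 : ∫ r in s..t, φ (U (t - r) (M (f r))) ≤
        ∫ r in s..t, (G r + ((b + L) * η + K * (t - s) * C - φ (AM (u t)))) := by
      refine intervalIntegral.integral_mono_on hst.le ?_ ((hGi _ _).add intervalIntegrable_const) ?_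
      · exact ⟨φ.integrable_comp (hMc t s t).1, φ.integrable_comp (hMc t s t).2⟩
      · intro r hr
        have hr' : r ∈ Icc 0 t1 := ⟨hs.1.trans hr.1, hr.2.trans ht.2⟩
        have d1 := hd r hr' t ht φ hφ1 hφ
        rw [map_add] at d1
        have d2 : φ (U (t - r) (M (f r))) ≤ φ (f r) + ‖M (f r) - f r‖ + K * (t - s) * C := by
          have a1 := hφle (U (t - r) (M (f r)) - M (f r))
          have a2 := hφle (M (f r) - f r)
          rw [map_sub] at a1 a2
          have a3 := hMK (t - r) (sub_nonneg.2 hr.2) (f r)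
          have a4 : K * (t - r) * ‖f r‖ ≤ K * (t - s) * C := by
            have := hr.1
            have := hr.2
            gcongr
            exact hfC r
          linarith
        have d3 : ‖M (u t)‖ ≤ ‖M (u r)‖ + η := by
          have := norm_sub_norm_le (M (u t)) (M (u r))
          rw [norm_sub_rev] at this
          linarith [hη r hr]
        have d4 : ‖u r - M (u t)‖ ≤ ‖u r - M (u r)‖ + η := by
          have := norm_sub_le_norm_sub_add_norm_sub (u r) (M (u r)) (M (u t))
          linarith [hη r hr]
        have d5 := mul_le_mul_of_nonneg_left d3 hb
        have d6 := mul_le_mul_of_nonneg_left d4 hL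
        simp only [hG]
        nlinarith
    rw [intervalIntegral.integral_add (hGi _ _) intervalIntegrable_const,
      intervalIntegral.integral_const, smul_eq_mul] at e3
    linarith
  -- conclude
  have hMu : Continuous fun t => M (u t) := M.continuous.comp hu
  have hprim : Continuous fun t => ∫ r in (0:ℝ)..t, G r :=
    intervalIntegral.continuous_primitive hGi 0
  have hfin : ∀ t ∈ Icc 0 t1, ‖M (u t)‖ - ∫ r in (0:ℝ)..t, G r ≤ ‖M x‖ := by
    intro t ht
    refine image_le_of_liminf_slope_right_le_deriv_boundary (a := 0) (b := t1)
      (f := fun t => ‖M (u t)‖ - ∫ r in (0:ℝ)..t, G r) (B := fun _ => ‖M x‖) (B' := fun _ => 0)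
      (hMu.norm.sub hprim).continuousOn ?_ continuousOn_const
      (fun y _ => hasDerivWithinAt_const _ _ _) ?_ ht
    · have := hueq 0 ⟨le_rfl, ht.1.trans ht.2⟩
      simp only [intervalIntegral.integral_same, add_zero, sub_zero, hU0] at this ⊢
      rw [this]; simp
    · intro s hs ε hε
      refine Eventually.frequently ?_
      obtain ⟨η, hη0, hη⟩ : ∃ η > 0, (b + L) * η < ε / 3 := by
        refine ⟨ε / 3 / (b + L + 1), by positivity, ?_⟩
        rw [mul_div_assoc', div_lt_iff₀ (by positivity)]
        nlinarith
      have hsub : Tendsto (fun t => t - s) (nhdsWithin s (Ioi s)) (nhdsWithin 0 (Ioi 0)) := by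
        refine tendsto_nhdsWithin_iff.2 ⟨?_, ?_⟩
        · have : Continuous fun t : ℝ => t - s := by fun_prop
          simpa using (this.tendsto s).mono_left nhdsWithin_le_nhds
        · filter_upwards [self_mem_nhdsWithin] with t ht using sub_pos.2 (mem_Ioi.1 ht)
      have c1 : ∀ᶠ t in nhdsWithin s (Ioi s),
          ‖(t - s)⁻¹ • (U (t - s) (M (u s)) - M (u s)) - AM (u t)‖ < ε / 3 := by
        have h1 := (hAM (u s)).comp hsub
        have h2 : Tendsto (fun t => AM (u t)) (nhdsWithin s (Ioi s)) (nhds (AM (u s))) :=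
          ((AM.continuous.comp hu).tendsto s).mono_left nhdsWithin_le_nhds
        have h3 := (h1.sub h2).norm
        rw [sub_self, norm_zero] at h3
        exact h3.eventually_lt_const (by positivity)
      have c2 : ∀ᶠ t in nhdsWithin s (Ioi s), K * (t - s) * C < ε / 3 := by
        have h1 : Tendsto (fun t => K * (t - s) * C) (nhdsWithin s (Ioi s)) (nhds 0) := by
          have : Continuous fun t : ℝ => K * (t - s) * C := by fun_prop
          simpa using (this.tendsto s).mono_left nhdsWithin_le_nhds
        exact h1.eventually_lt_const (by positivity)
      have c3 : ∀ᶠ t in nhdsWithin s (Ioi s), ∀ r ∈ Icc s t, ‖M (u r) - M (u t)‖ ≤ η := by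
        obtain ⟨δ, hδ, hδ'⟩ := Metric.continuousAt_iff.1 (hMu.continuousAt (x := s)) (η / 2) (by positivity)
        have : Ioo s (s + δ) ∈ nhdsWithin s (Ioi s) := Ioo_mem_nhdsGT (by linarith)
        filter_upwards [this] with t ht r hr
        have k1 := hδ' (x := r) (by
          rw [Real.dist_eq, abs_of_nonneg (by linarith [hr.1])]; linarith [hr.2, ht.2])
        have k2 := hδ' (x := t) (by
          rw [Real.dist_eq, abs_of_nonneg (by linarith [ht.1])]; linarith [ht.2])
        rw [← dist_eq_norm]
        have := dist_triangle_right (M (u r)) (M (u t)) (M (u s))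
        linarith
      have c4 : Ioo s t1 ∈ nhdsWithin s (Ioi s) := Ioo_mem_nhdsGT hs.2
      filter_upwards [c1, c2, c3, c4] with t h1 h2 h3 h4
      have hσ : 0 < t - s := sub_pos.2 h4.1
      have := hloc s ⟨hs.1, hs.2.le⟩ t ⟨hs.1.trans h4.1.le, h4.2.le⟩ h4.1 η h3
      rw [slope_def_field, div_lt_iff₀ hσ,
        ← intervalIntegral.integral_add_adjacent_intervals (hGi 0 s) (hGi s t)]
      have h5 := mul_lt_mul_of_pos_left (add_lt_add (add_lt_add h1 hη) h2) hσ
      linarith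
  intro t ht
  linarith [hfin t ht]

theorem aux_gronwall (y g : ℝ → ℝ) (hy : Continuous y) (hg : Continuous g) (hg0 : ∀ s, 0 ≤ g s)
    (b c t1 : ℝ) (hb : 0 ≤ b) (ht1 : 0 ≤ t1)
    (h : ∀ t ∈ Icc 0 t1, y t ≤ c + ∫ s in (0:ℝ)..t, (g s + b * y s)) :
    y t1 ≤ Real.exp (b * t1) * (c + ∫ s in (0:ℝ)..t1, g s) := by
  set Φ : ℝ → ℝ := fun t => c + ∫ s in (0:ℝ)..t, (g s + b * y s) with hΦ
  have hΦd : ∀ t, HasDerivAt Φ (g t + b * y t) t := fun t =>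
    ((Continuous.integral_hasStrictDerivAt (f := fun s => g s + b * y s)
      (by fun_prop) 0 t).hasDerivAt).const_add c
  have hId : ∀ t, HasDerivAt (fun t => ∫ s in (0:ℝ)..t, g s) (g t) t := fun t =>
    (hg.integral_hasStrictDerivAt 0 t).hasDerivAt
  have hE : ∀ t, HasDerivAt (fun t => Real.exp (-(b * t))) (Real.exp (-(b * t)) * (-(b * 1))) t :=
    fun t => ((hasDerivAt_id t).const_mul b).neg.exp
  have hΨ : ∀ t, HasDerivAt (fun t => Real.exp (-(b * t)) * Φ t - ∫ s in (0:ℝ)..t, g s)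
      (Real.exp (-(b * t)) * (-(b * 1)) * Φ t + Real.exp (-(b * t)) * (g t + b * y t) - g t) t :=
    fun t => ((hE t).mul (hΦd t)).sub (hId t)
  have hanti : AntitoneOn (fun t => Real.exp (-(b * t)) * Φ t - ∫ s in (0:ℝ)..t, g s) (Icc 0 t1) := by
    refine antitoneOn_of_deriv_nonpos (convex_Icc _ _)
      (fun t _ => (hΨ t).continuousAt.continuousWithinAt)
      (fun t _ => (hΨ t).differentiableAt.differentiableWithinAt) ?_
    intro t ht
    rw [interior_Icc] at ht
    rw [(hΨ t).deriv]
    have k1 : y t ≤ Φ t := h t ⟨ht.1.le, ht.2.le⟩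
    have k2 : Real.exp (-(b * t)) ≤ 1 := Real.exp_le_one_iff.2 (by have := ht.1; nlinarith)
    have k3 := Real.exp_pos (-(b * t))
    have k4 := mul_le_mul_of_nonneg_left (mul_le_mul_of_nonneg_left k1 hb) k3.le
    have k5 := mul_le_mul_of_nonneg_right k2 (hg0 t)
    nlinarith
  have h0 := hanti ⟨le_rfl, ht1⟩ ⟨ht1, le_rfl⟩ ht1
  simp only [hΦ, mul_zero, neg_zero, Real.exp_zero, one_mul, intervalIntegral.integral_same,
    add_zero, sub_zero] at h0
  have h1 := h t1 ⟨ht1, le_rfl⟩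
  refine h1.trans ?_
  have h2 := mul_le_mul_of_nonneg_left (sub_le_iff_le_add.1 h0) (Real.exp_pos (b * t1)).le
  rwa [← mul_assoc, ← Real.exp_add, add_neg_cancel, Real.exp_zero, one_mul] at h2


/-- Gronwall-type bound, Lemma 3.2 of the paper. -/
theorem stmt_13
    {B : Type*} [NormedAddCommGroup B] [NormedSpace ℝ B] [CompleteSpace B]
    -- (S(t))_{t ≥ 0} a strongly continuous contraction semigroup on B
    (S : ℝ → B →L[ℝ] B)
    (hS0 : S 0 = ContinuousLinearMap.id ℝ B)
    (hSadd : ∀ s ≥ (0:ℝ), ∀ t ≥ (0:ℝ), S (s + t) = (S s).comp (S t))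
    (hScontr : ∀ t ≥ (0:ℝ), ‖S t‖ ≤ 1)
    (hScont : ∀ x : B, ContinuousOn (fun t => S t x) (Set.Ici 0))
    -- the generator A with domain Adom
    (Adom : Set B) (A : B → B)
    (hAdom : ∀ x : B, x ∈ Adom ↔
      ∃ y : B, Tendsto (fun h : ℝ => h⁻¹ • (S h x - x)) (nhdsWithin 0 (Set.Ioi 0)) (nhds y))
    (hA : ∀ x ∈ Adom,
      Tendsto (fun h : ℝ => h⁻¹ • (S h x - x)) (nhdsWithin 0 (Set.Ioi 0)) (nhds (A x)))
    (T : ℝ) (hT : 0 < T)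
    (F : ℝ → B → B)
    -- (i) strong measurability
    (hFmeas : ∀ x : B, AEStronglyMeasurable (fun t => F t x) (volume.restrict (Set.Icc 0 T)))
    -- (ii) local Lipschitz continuity
    (hFlip : ∀ r : ℝ, 0 < r → ∃ L : ℝ, 0 ≤ L ∧ ∀ t ∈ Set.Icc 0 T, ∀ x y : B,
      ‖x‖ ≤ r → ‖y‖ ≤ r → ‖F t x - F t y‖ ≤ L * ‖x - y‖)
    -- (iii) uniform bound at 0
    (C₀ : ℝ) (hC₀ : 0 ≤ C₀) (hF0 : ∀ t ∈ Set.Icc 0 T, ‖F t 0‖ ≤ C₀)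
    -- (iv) the dissipativity-type estimate, with x* ∈ ∂‖x‖
    (a' b' N : ℝ) (ha' : 0 ≤ a') (hb' : 0 ≤ b') (hN : 1 ≤ N)
    (hdiss : ∀ t ∈ Set.Icc 0 T, ∀ x ∈ Adom, ∀ y : B, ∀ φ : B →L[ℝ] ℝ,
      ‖φ‖ = 1 → φ x = ‖x‖ → φ (A x + F t (x + y)) ≤ a' * (1 + ‖y‖) ^ N + b' * ‖x‖)
    (x : B) (τ : ℝ) (hτ : τ ∈ Set.Ioc 0 T)
    (u v : ℝ → B)
    (hucont : ContinuousOn u (Set.Ico 0 τ)) (hvcont : ContinuousOn v (Set.Ico 0 τ))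
    (hueq : ∀ t ∈ Set.Ico 0 τ, u t = S t x + ∫ s in (0:ℝ)..t, S (t - s) (F s (u s + v s))) :
    ∀ t ∈ Set.Ico 0 τ,
      ‖u t‖ ≤ Real.exp (b' * t) * (‖x‖ + ∫ s in (0:ℝ)..t, a' * (1 + ‖v s‖) ^ N) := by
  intro t1 ht1
  have hT1 : t1 ≤ T := ht1.2.le.trans hτ.2
  rcases subsingleton_or_nontrivial B with hB | hB
  · have : ‖u t1‖ = 0 := by rw [Subsingleton.elim (u t1) 0, norm_zero]
    rw [this]
    refine mul_nonneg (Real.exp_pos _).le (add_nonneg (norm_nonneg _) ?_)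
    refine intervalIntegral.integral_nonneg ht1.1 fun s _ => ?_
    positivity
  -- global versions
  let pr : ℝ → ℝ := fun s => max 0 (min s t1)
  have hprc : Continuous pr := by fun_prop
  have hprm : ∀ s, pr s ∈ Icc 0 t1 := fun s =>
    ⟨le_max_left _ _, max_le ht1.1 (min_le_right _ _)⟩
  have hpre : ∀ s ∈ Icc 0 t1, pr s = s := fun s hs => by
    simp only [pr]; rw [min_eq_left hs.2, max_eq_right hs.1]
  have hprI : ∀ s, pr s ∈ Ico 0 τ := fun s => ⟨(hprm s).1, (hprm s).2.trans_lt ht1.2⟩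
  let u' : ℝ → B := fun s => u (pr s)
  let v' : ℝ → B := fun s => v (pr s)
  have hu' : Continuous u' := hucont.comp_continuous hprc hprI
  have hv' : Continuous v' := hvcont.comp_continuous hprc hprI
  have hue : ∀ s ∈ Icc 0 t1, u' s = u s := fun s hs => by simp only [u', hpre s hs]
  have hve : ∀ s ∈ Icc 0 t1, v' s = v s := fun s hs => by simp only [v', hpre s hs]
  have hIs : Icc 0 t1 ⊆ Ico 0 τ := fun s hs => ⟨hs.1, hs.2.trans_lt ht1.2⟩
  obtain ⟨Ru, hRu⟩ := isCompact_Icc.exists_bound_of_continuousOn (hucont.mono hIs)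
  obtain ⟨Rv, hRv⟩ := isCompact_Icc.exists_bound_of_continuousOn (hvcont.mono hIs)
  have hRu' : ∀ s, ‖u' s‖ ≤ Ru := fun s => hRu _ (hprm s)
  have hRv' : ∀ s, ‖v' s‖ ≤ Rv := fun s => hRv _ (hprm s)
  have hRu0 : 0 ≤ Ru := (norm_nonneg _).trans (hRu' 0)
  have hRv0 : 0 ≤ Rv := (norm_nonneg _).trans (hRv' 0)
  obtain ⟨L, hL, hLip⟩ := hFlip (Ru + Rv + 1) (by positivity)
  let U : ℝ → B →L[ℝ] B := fun t => S (max t 0)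
  have hUS : ∀ t ≥ 0, U t = S t := fun t ht => by simp only [U, max_eq_left ht]
  have hU0 : U 0 = ContinuousLinearMap.id ℝ B := by rw [hUS 0 le_rfl, hS0]
  have hUadd : ∀ s ≥ (0:ℝ), ∀ t ≥ (0:ℝ), U (s + t) = (U s).comp (U t) := by
    intro s hs t ht
    rw [hUS _ (add_nonneg hs ht), hUS s hs, hUS t ht, hSadd s hs t ht]
  have hU1 : ∀ t, ‖U t‖ ≤ 1 := fun t => hScontr _ (le_max_right _ _)
  have hUc : ∀ x, Continuous fun t => U t x := fun x =>
    (hScont x).comp_continuous (f := fun t : ℝ => max t 0) (by fun_prop) (fun t => mem_Ici.2 (le_max_right _ _))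
  let f : ℝ → B := (Icc 0 t1).indicator fun s => F s (u' s + v' s)
  have hIT : ∀ s ∈ Icc 0 t1, s ∈ Icc 0 T := fun s hs => ⟨hs.1, hs.2.trans hT1⟩
  have hfe : ∀ s ∈ Icc 0 t1, f s = F s (u' s + v' s) := fun s hs => indicator_of_mem hs _
  have hfm : AEStronglyMeasurable f volume := by
    refine (aestronglyMeasurable_indicator_iff measurableSet_Icc).2 ?_
    exact (aux_meas F T hFmeas hFlip _ (hu'.add hv')).mono_measure
      (Measure.restrict_mono (fun s hs => hIT s hs) le_rfl)
  have hfC : ∀ s, ‖f s‖ ≤ C₀ + L * (Ru + Rv) := by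
    intro s
    by_cases hs : s ∈ Icc 0 t1
    · rw [hfe s hs]
      have k0 : ‖u' s + v' s‖ ≤ Ru + Rv := (norm_add_le _ _).trans (add_le_add (hRu' s) (hRv' s))
      have k1 := hLip s (hIT s hs) (u' s + v' s) 0 (by linarith) (by simp; positivity)
      rw [sub_zero] at k1
      have k2 := norm_le_norm_add_norm_sub' (F s (u' s + v' s)) (F s 0)
      have k3 := hF0 s (hIT s hs)
      have k4 := mul_le_mul_of_nonneg_left k0 hL
      linarith
    · simp only [f, indicator_of_notMem hs, norm_zero]
      positivity
  have hueq' : ∀ t ∈ Icc 0 t1, u' t = U t x + ∫ s in (0:ℝ)..t, U (t - s) (f s) := by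
    intro t ht
    rw [hue t ht, hueq t (hIs ht), hUS t ht.1]
    congr 1
    refine intervalIntegral.integral_congr fun r hr => ?_
    rw [uIcc_of_le ht.1] at hr
    have hr' : r ∈ Icc 0 t1 := ⟨hr.1, hr.2.trans ht.2⟩
    show S (t - r) (F r (u r + v r)) = U (t - r) (f r)
    rw [hUS _ (sub_nonneg.2 hr.2), hfe r hr', hue r hr', hve r hr']
  let g : ℝ → ℝ := fun s => a' * (1 + ‖v' s‖) ^ N
  have hg : Continuous g := by
    refine continuous_const.mul (Continuous.rpow_const (by fun_prop) fun s => Or.inr (by linarith))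
  have hg0 : ∀ s, 0 ≤ g s := fun s => by positivity
  obtain ⟨M, hM, hMlim⟩ := aux_M U hU0 hUadd hU1 hUc
  have hstep : ∀ h > 0, ∀ t ∈ Icc 0 t1, ‖M h (u' t)‖ ≤ ‖M h x‖ + ∫ r in (0:ℝ)..t,
      (g r + b' * ‖M h (u' r)‖ + L * ‖u' r - M h (u' r)‖ + ‖M h (f r) - f r‖) := by
    intro h hh
    obtain ⟨hM1, hMU, ⟨K, hK, hMK⟩, ⟨AM, hAM⟩⟩ := hM h hh
    refine aux_step U hU0 hUadd hU1 hUc (M h) AM K hK hM1 hMU hMK hAM f _ hfm hfC u' hu' g hg x t1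
      hueq' b' L hb' hL ?_
    intro r hr t ht φ hφ1 hφ
    have hlim : Tendsto (fun s : ℝ => s⁻¹ • (S s (M h (u' t)) - M h (u' t)))
        (nhdsWithin 0 (Set.Ioi 0)) (nhds (AM (u' t))) := by
      refine (hAM (u' t)).congr' ?_
      filter_upwards [self_mem_nhdsWithin] with s hs
      rw [hUS s (le_of_lt hs)]
    have hdom : M h (u' t) ∈ Adom := (hAdom _).2 ⟨_, hlim⟩
    have hAe : A (M h (u' t)) = AM (u' t) := tendsto_nhds_unique (hA _ hdom) hlim
    have k1 := hdiss r (hIT r hr) _ hdom (v' r) φ hφ1 hφ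
    rw [hAe, map_add] at k1
    have k2 := hLip r (hIT r hr) (u' r + v' r) (M h (u' t) + v' r)
      ((norm_add_le _ _).trans (by linarith [hRu' r, hRv' r]))
      ((norm_add_le _ _).trans (by linarith [(hM1 (u' t)).trans (hRu' t), hRv' r]))
    rw [add_sub_add_right_eq_sub] at k2
    have k3 := (le_abs_self _).trans (φ.le_opNorm (F r (u' r + v' r) - F r (M h (u' t) + v' r)))
    rw [hφ1, one_mul, map_sub] at k3
    rw [map_add, hfe r hr]
    simp only [g]
    linarith
  have hlimit : ∀ t ∈ Icc 0 t1, ‖u' t‖ ≤ ‖x‖ + ∫ r in (0:ℝ)..t, (g r + b' * ‖u' r‖) := by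
    intro t ht
    have hl : Tendsto (fun h => ∫ r in (0:ℝ)..t,
        (g r + b' * ‖M h (u' r)‖ + L * ‖u' r - M h (u' r)‖ + ‖M h (f r) - f r‖))
        (nhdsWithin 0 (Ioi 0)) (nhds (∫ r in (0:ℝ)..t, (g r + b' * ‖u' r‖))) := by
      refine intervalIntegral.tendsto_integral_filter_of_dominated_convergence
        (fun r => g r + b' * Ru + L * (Ru + Ru) +
          ((C₀ + L * (Ru + Rv)) + (C₀ + L * (Ru + Rv)))) ?_ ?_ ?_ ?_
      · filter_upwards with h
        refine AEStronglyMeasurable.restrict ?_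
        refine AEStronglyMeasurable.add ?_
          (((M h).continuous.comp_aestronglyMeasurable hfm).sub hfm).norm
        exact Continuous.aestronglyMeasurable (by fun_prop)
      · filter_upwards [self_mem_nhdsWithin] with h hh
        filter_upwards with r _
        have hM1 := (hM h hh).1
        have m1 := (hM1 (u' r)).trans (hRu' r)
        have m2 := (norm_sub_le _ _).trans (add_le_add (hRu' r) m1)
        have m3 := (norm_sub_le _ _).trans (add_le_add ((hM1 (f r)).trans (hfC r)) (hfC r))
        have := hg0 r
        rw [Real.norm_of_nonneg (by positivity)]
        gcongr
      · exact Continuous.intervalIntegrable (by fun_prop) _ _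
      · filter_upwards with r _
        have l1 := hMlim (u' r)
        have l2 := hMlim (f r)
        have := (((l1.norm.const_mul b').const_add (g r)).add
          (((tendsto_const_nhds (x := u' r)).sub l1).norm.const_mul L)).add
          ((l2.sub (tendsto_const_nhds (x := f r))).norm)
        simpa using this
    refine le_of_tendsto_of_tendsto (hMlim (u' t)).norm ((hMlim x).norm.add hl) ?_
    filter_upwards [self_mem_nhdsWithin] with h hh
    exact hstep h hh t ht
  have hfinal := aux_gronwall (fun s => ‖u' s‖) g hu'.norm hg hg0 b' ‖x‖ t1 hb' ht1.1 hlimit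
  have hgi : ∫ s in (0:ℝ)..t1, g s = ∫ s in (0:ℝ)..t1, a' * (1 + ‖v s‖) ^ N := by
    refine intervalIntegral.integral_congr fun r hr => ?_
    rw [uIcc_of_le ht1.1] at hr
    show a' * (1 + ‖v' r‖) ^ N = a' * (1 + ‖v r‖) ^ N
    rw [hve r hr]
  rw [hgi] at hfinal
  simpa only [hue t1 ⟨ht1.1, le_rfl⟩] using hfinal
end
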